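/- arXiv:1404.2755 — 3 statements merged into one kernel-verified Lean document; each statement's English description precedes it below -/
import Mathlib

section
/- Let k be a field, let x_1,…,x_n and y_1,…,y_m be variables over k, let I be an ideal of R = k[x_1,…,x_n] and J an ideal of S = k[y_1,…,y_m]. If there exists an isomorphism of k-algebras R/I ≅ S/J, then rt(I) = rt(J). -/
open Polynomial MvPolynomial

/-- The kernel of the graded presentation `R[t₁,…,t_s] → 𝐑(I) ⊆ R[X]` of the Rees algebra
of the ideal generated by `f`, sending `tᵢ` to `(f i)·X`. -/
noncomputable def reesKer {R : Type*} [CommRing R] {s : ℕ} (f : Fin s → R) :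
    Ideal (MvPolynomial (Fin s) R) :=
  RingHom.ker (MvPolynomial.aeval
    (fun i => Polynomial.C (f i) * Polynomial.X) : MvPolynomial (Fin s) R →ₐ[R] Polynomial R)

/-- `L` is generated by its homogeneous elements of degree at most `N`. -/
def GenInDegLE {R : Type*} [CommRing R] {s : ℕ}
    (L : Ideal (MvPolynomial (Fin s) R)) (N : ℕ) : Prop :=
  L = Ideal.span {p | p ∈ L ∧ ∃ q ≤ N, MvPolynomial.IsHomogeneous p q}

/-- The relation type of an ideal `I`: the least `N ≥ 1` such that, for every finite
generating family of `I`, the ideal of equations of the corresponding presentation of the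
Rees algebra is generated by its homogeneous elements of degree at most `N`. -/
noncomputable def relType {R : Type*} [CommRing R] (I : Ideal R) : ℕ :=
  sInf {N | 1 ≤ N ∧ ∀ (s : ℕ) (f : Fin s → R),
    Ideal.span (Set.range f) = I → GenInDegLE (reesKer f) N}

/-- The kernel of the presentation of the Rees algebra attached to a family over any index type. -/
noncomputable def reesRelations {R σ : Type*} [CommRing R] (f : σ → R) :
    Ideal (MvPolynomial σ R) :=
  RingHom.ker (MvPolynomial.aeval
    (fun i => Polynomial.C (f i) * Polynomial.X) : MvPolynomial σ R →ₐ[R] Polynomial R)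

/-- The ideal generated by the homogeneous elements of degree at most `N` of an ideal. -/
noncomputable def lowDegreePart {R σ : Type*} [CommRing R] (L : Ideal (MvPolynomial σ R)) (N : ℕ) :
    Ideal (MvPolynomial σ R) :=
  Ideal.span {p | p ∈ L ∧ ∃ q ≤ N, MvPolynomial.IsHomogeneous p q}

section Relations

variable {R R' σ τ : Type*} [CommRing R] [CommRing R']

theorem lowDegreePart_le (L : Ideal (MvPolynomial σ R)) (N : ℕ) : lowDegreePart L N ≤ L :=
  Ideal.span_le.mpr fun _ hp => hp.1

theorem mem_reesRelations {f : σ → R} {p : MvPolynomial σ R} :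
    p ∈ reesRelations f ↔
      MvPolynomial.aeval (fun i => Polynomial.C (f i) * Polynomial.X) p = 0 :=
  RingHom.mem_ker

theorem aeval_eval₂Hom_of_compat {f : σ → R} {f' : τ → R'} (g : R →+* R')
    (h : σ → MvPolynomial τ R')
    (hφ : ∀ i, MvPolynomial.aeval (fun j => Polynomial.C (f' j) * Polynomial.X) (h i) =
      Polynomial.C (g (f i)) * Polynomial.X) (p : MvPolynomial σ R) :
    MvPolynomial.aeval (fun j => Polynomial.C (f' j) * Polynomial.X)
        (MvPolynomial.eval₂Hom (MvPolynomial.C.comp g) h p) =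
      Polynomial.map g
        (MvPolynomial.aeval (fun i => Polynomial.C (f i) * Polynomial.X) p) := by
  induction p using MvPolynomial.induction_on with
  | C a => simp
  | add p q hp hq => simp only [map_add, hp, hq, Polynomial.map_add]
  | mul_X p i hp => simp only [map_mul, hp, Polynomial.map_mul, MvPolynomial.eval₂Hom_X', hφ,
      MvPolynomial.aeval_X, Polynomial.map_C, Polynomial.map_X]

theorem eval₂Hom_mem_reesRelations {f : σ → R} {f' : τ → R'} (g : R →+* R')
    (h : σ → MvPolynomial τ R')
    (hφ : ∀ i, MvPolynomial.aeval (fun j => Polynomial.C (f' j) * Polynomial.X) (h i) =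
      Polynomial.C (g (f i)) * Polynomial.X) {p : MvPolynomial σ R} (hp : p ∈ reesRelations f) :
    MvPolynomial.eval₂Hom (MvPolynomial.C.comp g) h p ∈ reesRelations f' := by
  rw [mem_reesRelations] at hp ⊢
  rw [aeval_eval₂Hom_of_compat g h hφ, hp, Polynomial.map_zero]

theorem isHomogeneous_eval₂Hom (g : R →+* R') (h : σ → MvPolynomial τ R')
    (hh : ∀ i, (h i).IsHomogeneous 1) {p : MvPolynomial σ R} {q : ℕ} (hp : p.IsHomogeneous q) :
    (MvPolynomial.eval₂Hom (MvPolynomial.C.comp g) h p).IsHomogeneous q := by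
  simpa using hp.eval₂ (MvPolynomial.C.comp g) h (fun r => MvPolynomial.isHomogeneous_C _ _) hh

theorem eval₂Hom_mem_lowDegreePart {f : σ → R} {f' : τ → R'} (g : R →+* R')
    (h : σ → MvPolynomial τ R') (hh : ∀ i, (h i).IsHomogeneous 1)
    (hφ : ∀ i, MvPolynomial.aeval (fun j => Polynomial.C (f' j) * Polynomial.X) (h i) =
      Polynomial.C (g (f i)) * Polynomial.X) {N : ℕ} {p : MvPolynomial σ R}
    (hp : p ∈ lowDegreePart (reesRelations f) N) :
    MvPolynomial.eval₂Hom (MvPolynomial.C.comp g) h p ∈ lowDegreePart (reesRelations f') N := by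
  suffices lowDegreePart (reesRelations f) N ≤
      (lowDegreePart (reesRelations f') N).comap
        (MvPolynomial.eval₂Hom (MvPolynomial.C.comp g) h) from this hp
  refine Ideal.span_le.mpr ?_
  rintro r ⟨hr, q, hq, hrq⟩
  exact Ideal.subset_span
    ⟨eval₂Hom_mem_reesRelations g h hφ hr, q, hq, isHomogeneous_eval₂Hom g h hh hrq⟩

/-- If the presentation of `f` is a graded retract, up to linear relations, of that of `f'`, then
bounds on the degrees of generators of the relations pass from `f'` to `f`. -/
theorem reesRelations_le_of_retract {f : σ → R} {f' : τ → R'} {N : ℕ} (hN : 1 ≤ N)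
    (g : R →+* R') (h : σ → MvPolynomial τ R') (hh : ∀ i, (h i).IsHomogeneous 1)
    (hφ : ∀ i, MvPolynomial.aeval (fun j => Polynomial.C (f' j) * Polynomial.X) (h i) =
      Polynomial.C (g (f i)) * Polynomial.X)
    (g' : R' →+* R) (h' : τ → MvPolynomial σ R) (hh' : ∀ j, (h' j).IsHomogeneous 1)
    (hφ' : ∀ j, MvPolynomial.aeval (fun i => Polynomial.C (f i) * Polynomial.X) (h' j) =
      Polynomial.C (g' (f' j)) * Polynomial.X)
    (hg : ∀ r, g' (g r) = r)
    (hL : reesRelations f' ≤ lowDegreePart (reesRelations f') N) :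
    reesRelations f ≤ lowDegreePart (reesRelations f) N := by
  intro p hp
  set α := MvPolynomial.eval₂Hom (MvPolynomial.C.comp g) h with hα
  set β := MvPolynomial.eval₂Hom (MvPolynomial.C.comp g') h' with hβ
  have hβα : β (α p) ∈ lowDegreePart (reesRelations f) N :=
    eval₂Hom_mem_lowDegreePart g' h' hh' hφ' (hL (eval₂Hom_mem_reesRelations g h hφ hp))
  have key : (Ideal.Quotient.mk (lowDegreePart (reesRelations f) N)) =
      ((Ideal.Quotient.mk (lowDegreePart (reesRelations f) N)).comp β).comp α := by
    refine MvPolynomial.ringHom_ext (fun r => ?_) fun i => ?_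
    · simp [hα, hβ, hg]
    · refine Ideal.Quotient.eq.mpr (Ideal.subset_span ⟨?_, 1, hN, ?_⟩)
      · change _ - β (α _) ∈ _
        rw [mem_reesRelations, map_sub, aeval_eval₂Hom_of_compat g' h' hφ',
          aeval_eval₂Hom_of_compat g h hφ]
        simp [hg]
      · exact (MvPolynomial.isHomogeneous_X R i).sub
          (isHomogeneous_eval₂Hom g' h' hh'
            (isHomogeneous_eval₂Hom g h hh (MvPolynomial.isHomogeneous_X R i)))
  have := Ideal.Quotient.eq.mp (congrArg (fun F => F p) key)
  have := add_mem this hβα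
  simpa using this

theorem exists_linear_form [Fintype σ] (f : σ → R) {x : R} (hx : x ∈ Ideal.span (Set.range f)) :
    ∃ l : MvPolynomial σ R, l.IsHomogeneous 1 ∧
      MvPolynomial.aeval (fun i => Polynomial.C (f i) * Polynomial.X) l =
        Polynomial.C x * Polynomial.X := by
  obtain ⟨c, rfl⟩ := Ideal.mem_span_range_iff_exists_fun.mp hx
  refine ⟨∑ i, MvPolynomial.C (c i) * MvPolynomial.X i,
    MvPolynomial.IsHomogeneous.sum _ _ _ fun i _ => MvPolynomial.isHomogeneous_C_mul_X _ _, ?_⟩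
  simp [Finset.sum_mul, mul_assoc]

/-- Degree bounds for the relations do not depend on the generating family. -/
theorem reesRelations_le_of_span_eq [Fintype σ] [Fintype τ] {f : σ → R} {f' : τ → R}
    (hf : Ideal.span (Set.range f) = Ideal.span (Set.range f')) {N : ℕ} (hN : 1 ≤ N)
    (hL : reesRelations f' ≤ lowDegreePart (reesRelations f') N) :
    reesRelations f ≤ lowDegreePart (reesRelations f) N := by
  choose h hh hφ using fun i =>
    exists_linear_form f' (hf ▸ Ideal.subset_span (Set.mem_range_self i) : f i ∈ _)
  choose h' hh' hφ' using fun j =>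
    exists_linear_form f (hf ▸ Ideal.subset_span (Set.mem_range_self j) : f' j ∈ _)
  exact reesRelations_le_of_retract hN (RingHom.id R) h hh hφ (RingHom.id R) h' hh' hφ'
    (fun _ => rfl) hL

theorem relType_eq_sInf [Fintype σ] (f : σ → R) {I : Ideal R}
    (hf : Ideal.span (Set.range f) = I) :
    relType I =
      sInf {N | 1 ≤ N ∧ reesRelations f ≤ lowDegreePart (reesRelations f) N} := by
  unfold relType
  congr 1
  ext N
  refine and_congr_right fun hN => ⟨fun H => ?_, fun H s f' hf' => ?_⟩
  · let ε := Fintype.equivFin σ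
    have hr : Ideal.span (Set.range (f ∘ ε.symm)) = I := by
      rw [ε.symm.surjective.range_comp, hf]
    exact reesRelations_le_of_span_eq (hf.trans hr.symm) hN (H _ (f ∘ ε.symm) hr).le
  · exact le_antisymm (reesRelations_le_of_span_eq (hf'.trans hf.symm) hN H)
      (lowDegreePart_le _ N)

theorem relType_map_equiv [IsNoetherianRing R] (e : R ≃+* R') (I : Ideal R) :
    relType (I.map (e : R →+* R')) = relType I := by
  obtain ⟨s, f, hf⟩ :=
    Submodule.fg_iff_exists_fin_generating_family.mp (IsNoetherian.noetherian I)
  replace hf : Ideal.span (Set.range f) = I := hf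
  have hf' : Ideal.span (Set.range (fun i => e (f i))) = I.map (e : R →+* R') := by
    rw [← hf, Ideal.map_span, ← Set.range_comp]
    rfl
  rw [relType_eq_sInf f hf, relType_eq_sInf _ hf']
  congr 1
  ext N
  refine and_congr_right fun hN => ⟨?_, ?_⟩
  · exact reesRelations_le_of_retract hN (e : R →+* R') MvPolynomial.X
      (MvPolynomial.isHomogeneous_X _) (by simp) (e.symm : R' →+* R) MvPolynomial.X
      (MvPolynomial.isHomogeneous_X _) (by simp) (by simp)
  · exact reesRelations_le_of_retract hN (e.symm : R' →+* R) MvPolynomial.X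
      (MvPolynomial.isHomogeneous_X _) (by simp) (e : R →+* R') MvPolynomial.X
      (MvPolynomial.isHomogeneous_X _) (by simp) (by simp)

theorem relType_ker_comp_equiv {B : Type*} [CommRing B] [IsNoetherianRing R] (e : R ≃+* R')
    (ψ : R' →+* B) : relType (RingHom.ker (ψ.comp (e : R →+* R'))) = relType (RingHom.ker ψ) := by
  rw [← relType_map_equiv e]
  congr 1
  exact Ideal.map_comap_of_surjective (e : R →+* R') e.surjective (RingHom.ker ψ)

end Relations

section AdjoinVariable

variable {R σ : Type*} [CommRing R]

/-- The family `f` together with the variable of the polynomial ring `R[y]`. -/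
noncomputable def adjoinVar (f : σ → R) : Option σ → Polynomial R :=
  fun o => o.elim Polynomial.X fun i => Polynomial.C (f i)

/-- The inclusion of `R[t]` into `R[y][t, w]`. -/
noncomputable def inclRelations (R σ : Type*) [CommRing R] :
    MvPolynomial σ R →+* MvPolynomial (Option σ) (Polynomial R) :=
  MvPolynomial.eval₂Hom (MvPolynomial.C.comp Polynomial.C) fun i => MvPolynomial.X (some i)

/-- The map `R[t][w] → R[y][t, w]`. -/
noncomputable def normalFormLeft (R σ : Type*) [CommRing R] :
    Polynomial (MvPolynomial σ R) →+* MvPolynomial (Option σ) (Polynomial R) :=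
  Polynomial.eval₂RingHom (inclRelations R σ) (MvPolynomial.X none)

/-- The map `R[y][w] → R[y][t, w]`. -/
noncomputable def normalFormRight (R σ : Type*) [CommRing R] :
    Polynomial (Polynomial R) →+* MvPolynomial (Option σ) (Polynomial R) :=
  Polynomial.eval₂RingHom MvPolynomial.C (MvPolynomial.X none)

theorem compat_some (f : σ → R) (i : σ) :
    MvPolynomial.aeval (fun j => Polynomial.C (adjoinVar f j) * Polynomial.X)
        (MvPolynomial.X (some i) : MvPolynomial (Option σ) (Polynomial R)) =
      Polynomial.C (Polynomial.C (f i)) * Polynomial.X := by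
  simp [adjoinVar]

theorem reesRelations_le_of_adjoinVar (f : σ → R) {N : ℕ} (hN : 1 ≤ N)
    (hL : reesRelations (adjoinVar f) ≤ lowDegreePart (reesRelations (adjoinVar f)) N) :
    reesRelations f ≤ lowDegreePart (reesRelations f) N := by
  refine reesRelations_le_of_retract hN Polynomial.C (fun i => MvPolynomial.X (some i))
    (fun i => MvPolynomial.isHomogeneous_X _ _) (compat_some f) (Polynomial.evalRingHom 0)
    (fun o => o.elim 0 MvPolynomial.X) ?_ ?_ (by simp) hL
  · rintro (_ | i)
    · exact MvPolynomial.isHomogeneous_zero _ _ _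
    · exact MvPolynomial.isHomogeneous_X _ _
  · rintro (_ | i) <;> simp [adjoinVar]

theorem coeff_aeval_normalFormLeft (f : σ → R) (a : Polynomial (MvPolynomial σ R)) (n d : ℕ) :
    ((MvPolynomial.aeval (fun j => Polynomial.C (adjoinVar f j) * Polynomial.X)
        (normalFormLeft R σ a)).coeff n).coeff d =
      if d ≤ n then (MvPolynomial.aeval (fun i => Polynomial.C (f i) * Polynomial.X)
        (a.coeff d)).coeff (n - d) else 0 := by
  induction a using Polynomial.induction_on' with
  | add p q hp hq =>
    simp only [map_add, Polynomial.coeff_add, hp, hq]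
    split_ifs <;> simp
  | monomial j c =>
    have h1 : MvPolynomial.aeval (fun j => Polynomial.C (adjoinVar f j) * Polynomial.X)
        (normalFormLeft R σ (Polynomial.monomial j c)) =
        Polynomial.C (Polynomial.X ^ j) * (Polynomial.map Polynomial.C
          (MvPolynomial.aeval (fun i => Polynomial.C (f i) * Polynomial.X) c) *
            Polynomial.X ^ j) := by
      simp only [normalFormLeft, Polynomial.coe_eval₂RingHom, Polynomial.eval₂_monomial, map_mul,
        map_pow, inclRelations, aeval_eval₂Hom_of_compat _ _ (compat_some f),
        MvPolynomial.aeval_X]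
      simp only [adjoinVar, Option.elim, mul_pow]
      ring
    rw [h1, Polynomial.coeff_C_mul, Polynomial.coeff_mul_X_pow', Polynomial.coeff_monomial]
    by_cases hjn : j ≤ n
    · rw [if_pos hjn, Polynomial.coeff_map, Polynomial.coeff_X_pow_mul', Polynomial.coeff_C]
      grind [Polynomial.coeff_zero]
    · rw [if_neg hjn]
      grind [Polynomial.coeff_zero]

theorem coeff_aeval_normalFormRight (f : σ → R) (b : Polynomial (Polynomial R)) (n : ℕ) :
    (MvPolynomial.aeval (fun j => Polynomial.C (adjoinVar f j) * Polynomial.X)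
        (normalFormRight R σ b)).coeff n = b.coeff n * Polynomial.X ^ n := by
  induction b using Polynomial.induction_on' with
  | add p q hp hq => simp only [map_add, Polynomial.coeff_add, hp, hq, add_mul]
  | monomial j c =>
    have h1 : MvPolynomial.aeval (fun j => Polynomial.C (adjoinVar f j) * Polynomial.X)
        (normalFormRight R σ (Polynomial.monomial j c)) =
        Polynomial.C (c * Polynomial.X ^ j) * Polynomial.X ^ j := by
      simp [normalFormRight, Polynomial.eval₂_monomial, adjoinVar, mul_pow, mul_assoc]
    rw [h1, Polynomial.coeff_C_mul_X_pow, Polynomial.coeff_monomial]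
    grind

/-- Elements of the form `a + y b` with `a ∈ R[t][w]` and `b ∈ R[y][w]`, modulo an ideal. -/
def HasNormalForm (G : Ideal (MvPolynomial (Option σ) (Polynomial R)))
    (p : MvPolynomial (Option σ) (Polynomial R)) : Prop :=
  ∃ a b, p - (normalFormLeft R σ a + MvPolynomial.C Polynomial.X * normalFormRight R σ b) ∈ G

theorem HasNormalForm.add {G : Ideal (MvPolynomial (Option σ) (Polynomial R))}
    {p q : MvPolynomial (Option σ) (Polynomial R)} (hp : HasNormalForm G p)
    (hq : HasNormalForm G q) : HasNormalForm G (p + q) := by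
  obtain ⟨a, b, h⟩ := hp
  obtain ⟨a', b', h'⟩ := hq
  refine ⟨a + a', b + b', ?_⟩
  convert add_mem h h' using 1
  simp only [map_add]
  ring

theorem HasNormalForm.of_sub_mem {G : Ideal (MvPolynomial (Option σ) (Polynomial R))}
    {p q : MvPolynomial (Option σ) (Polynomial R)} (hq : HasNormalForm G q)
    (h : p - q ∈ G) : HasNormalForm G p := by
  obtain ⟨a, b, h'⟩ := hq
  refine ⟨a, b, ?_⟩
  convert add_mem h h' using 1
  ring

theorem hasNormalForm_left (G : Ideal (MvPolynomial (Option σ) (Polynomial R)))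
    (a : Polynomial (MvPolynomial σ R)) : HasNormalForm G (normalFormLeft R σ a) :=
  ⟨a, 0, by simp⟩

theorem hasNormalForm_right (G : Ideal (MvPolynomial (Option σ) (Polynomial R)))
    (b : Polynomial (Polynomial R)) : HasNormalForm G (normalFormRight R σ b) := by
  induction b using Polynomial.induction_on' with
  | add p q hp hq => simpa only [map_add] using hp.add hq
  | monomial j c =>
    refine ⟨Polynomial.monomial j (MvPolynomial.C (c.coeff 0)),
      Polynomial.monomial j c.divX, ?_⟩
    convert G.zero_mem
    have hc : (MvPolynomial.C c : MvPolynomial (Option σ) (Polynomial R)) =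
        MvPolynomial.C c.divX * MvPolynomial.C Polynomial.X +
          MvPolynomial.C (Polynomial.C (c.coeff 0)) := by
      rw [← map_mul, ← map_add, Polynomial.divX_mul_X_add]
    simp only [normalFormLeft, normalFormRight, inclRelations, Polynomial.coe_eval₂RingHom,
      Polynomial.eval₂_monomial, MvPolynomial.eval₂Hom_C, RingHom.comp_apply, hc]
    ring

theorem hasNormalForm {f : σ → R} {G : Ideal (MvPolynomial (Option σ) (Polynomial R))}
    (hG : ∀ i, MvPolynomial.C Polynomial.X * MvPolynomial.X (some i) -
      MvPolynomial.C (Polynomial.C (f i)) * MvPolynomial.X none ∈ G)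
    (p : MvPolynomial (Option σ) (Polynomial R)) : HasNormalForm G p := by
  induction p using MvPolynomial.induction_on with
  | C c => simpa [normalFormRight] using hasNormalForm_right G (Polynomial.C c)
  | add p q hp hq => exact hp.add hq
  | mul_X p o hp =>
    obtain ⟨a, b, h⟩ := hp
    refine HasNormalForm.of_sub_mem ?_ (by simpa only [sub_mul] using G.mul_mem_right (.X o) h)
    rw [add_mul]
    rcases o with _ | i
    · refine (hasNormalForm_left G (a * Polynomial.X)).of_sub_mem ?_ |>.add
        ⟨0, b * Polynomial.X, ?_⟩
      · convert G.zero_mem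
        simp [normalFormLeft]
      · convert G.zero_mem
        simp [normalFormRight, mul_assoc]
    · refine (hasNormalForm_left G (a * Polynomial.C (MvPolynomial.X i))).of_sub_mem ?_ |>.add <|
        (hasNormalForm_right G
          (Polynomial.C (Polynomial.C (f i)) * Polynomial.X * b)).of_sub_mem ?_
      · convert G.zero_mem
        simp [normalFormLeft, inclRelations]
      · convert G.mul_mem_right (normalFormRight R σ b) (hG i) using 1
        simp [normalFormRight]
        ring

theorem adjoinVar_reesRelations_le (f : σ → R) {N : ℕ} (hN : 1 ≤ N)
    (hL : reesRelations f ≤ lowDegreePart (reesRelations f) N) :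
    reesRelations (adjoinVar f) ≤ lowDegreePart (reesRelations (adjoinVar f)) N := by
  set G := lowDegreePart (reesRelations (adjoinVar f)) N with hG
  have hlin : ∀ i, MvPolynomial.C Polynomial.X * MvPolynomial.X (some i) -
      MvPolynomial.C (Polynomial.C (f i)) * MvPolynomial.X none ∈ G := by
    refine fun i => Ideal.subset_span ⟨?_, 1, hN, ?_⟩
    · rw [mem_reesRelations]
      simp only [map_sub, map_mul, MvPolynomial.aeval_X, MvPolynomial.aeval_C, adjoinVar,
        Option.elim, Polynomial.algebraMap_eq]
      ring
    · exact (MvPolynomial.isHomogeneous_C_mul_X _ _).sub (MvPolynomial.isHomogeneous_C_mul_X _ _)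
  intro p hp
  obtain ⟨a, b, hab⟩ := hasNormalForm hlin p
  have hz := sub_mem hp (lowDegreePart_le _ _ hab)
  rw [sub_sub_cancel, mem_reesRelations, map_add, map_mul] at hz
  have hcoeff : ∀ n d, (if d ≤ n then
      (MvPolynomial.aeval (fun i => Polynomial.C (f i) * Polynomial.X)
        (a.coeff d)).coeff (n - d) else 0) +
        (b.coeff n * Polynomial.X ^ (n + 1)).coeff d = 0 := by
    intro n d
    have := congrArg (fun q => (q.coeff n).coeff d) hz
    simp only [Polynomial.coeff_add, coeff_aeval_normalFormLeft, MvPolynomial.aeval_C,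
      Polynomial.algebraMap_eq, Polynomial.coeff_C_mul, coeff_aeval_normalFormRight,
      Polynomial.coeff_zero] at this
    rw [← this]
    congr 2
    ring
  have hb : b = 0 := by
    ext n i
    have := hcoeff n (i + (n + 1))
    rw [Polynomial.coeff_mul_X_pow, if_neg (by omega), zero_add] at this
    simpa using this
  have ha : ∀ d, a.coeff d ∈ reesRelations f := by
    intro d
    rw [mem_reesRelations]
    ext n
    simpa [hb] using hcoeff (n + d) d
  have hleft : normalFormLeft R σ a ∈ G := by
    rw [normalFormLeft, Polynomial.coe_eval₂RingHom, Polynomial.eval₂_eq_sum, Polynomial.sum_def]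
    exact sum_mem fun d _ => G.mul_mem_right _ <| eval₂Hom_mem_lowDegreePart _ _
      (fun i => MvPolynomial.isHomogeneous_X _ _) (compat_some f) (hL (ha d))
  rw [hb, map_zero, mul_zero, add_zero] at hab
  simpa using add_mem hab hleft

variable {B : Type*} [CommRing B] [IsNoetherianRing R]

theorem relType_ker_of_map_X_eq_zero (ψ : Polynomial R →+* B) (hψ : ψ Polynomial.X = 0) :
    relType (RingHom.ker ψ) = relType (RingHom.ker (ψ.comp Polynomial.C)) := by
  obtain ⟨s, f, hf⟩ := Submodule.fg_iff_exists_fin_generating_family.mp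
    (IsNoetherian.noetherian (RingHom.ker (ψ.comp Polynomial.C)))
  replace hf : Ideal.span (Set.range f) = RingHom.ker (ψ.comp Polynomial.C) := hf
  have hf' : Ideal.span (Set.range (adjoinVar f)) = RingHom.ker ψ := by
    apply le_antisymm
    · rw [Ideal.span_le]
      rintro _ ⟨_ | i, rfl⟩
      · exact hψ
      · exact hf.le (Ideal.subset_span ⟨i, rfl⟩)
    · intro p hp
      have hX : Polynomial.X ∈ Ideal.span (Set.range (adjoinVar f)) :=
        Ideal.subset_span ⟨none, rfl⟩
      have hC : Ideal.span (Set.range f) ≤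
          (Ideal.span (Set.range (adjoinVar f))).comap Polynomial.C := by
        rw [Ideal.span_le]
        rintro _ ⟨i, rfl⟩
        exact Ideal.subset_span ⟨some i, rfl⟩
      rw [← Polynomial.divX_mul_X_add p] at hp ⊢
      refine add_mem (Ideal.mul_mem_left _ _ hX) (hC (hf.ge ?_))
      simpa [RingHom.mem_ker, hψ] using hp
  rw [relType_eq_sInf _ hf, relType_eq_sInf _ hf']
  congr 1
  ext N
  exact and_congr_right fun hN =>
    ⟨reesRelations_le_of_adjoinVar f hN, adjoinVar_reesRelations_le f hN⟩

theorem relType_ker_polynomial (ψ : Polynomial R →+* B)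
    (hψ : Function.Surjective (ψ.comp Polynomial.C)) :
    relType (RingHom.ker ψ) = relType (RingHom.ker (ψ.comp Polynomial.C)) := by
  obtain ⟨a, ha⟩ := hψ (ψ Polynomial.X)
  let e : Polynomial R ≃+* Polynomial R := (Polynomial.algEquivAevalXAddC (-a)).toRingEquiv
  have heX : e Polynomial.X = Polynomial.X - Polynomial.C a := by
    simp [e, sub_eq_add_neg]
  have heC : ∀ r, e (Polynomial.C r) = Polynomial.C r := fun r => by simp [e]
  rw [← relType_ker_comp_equiv e, relType_ker_of_map_X_eq_zero]
  · congr 2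
    ext r
    simp [heC]
  · simpa [heX, sub_eq_zero] using ha.symm

end AdjoinVariable

theorem relType_ker_mvPolynomial {R B : Type*} [CommRing R] [CommRing B] [IsNoetherianRing R]
    (m : ℕ) (ψ : MvPolynomial (Fin m) R →+* B)
    (hψ : Function.Surjective (ψ.comp MvPolynomial.C)) :
    relType (RingHom.ker ψ) = relType (RingHom.ker (ψ.comp MvPolynomial.C)) := by
  induction m with
  | zero =>
    rw [← relType_ker_comp_equiv (MvPolynomial.isEmptyRingEquiv R (Fin 0)).symm ψ]
    congr 2
  | succ m ih =>
    let e : MvPolynomial (Fin (m + 1)) R ≃+* Polynomial (MvPolynomial (Fin m) R) :=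
      (MvPolynomial.finSuccEquiv R m).toRingEquiv
    let χ := (ψ.comp
      (e.symm : Polynomial (MvPolynomial (Fin m) R) →+* MvPolynomial (Fin (m + 1)) R)).comp
        Polynomial.C
    have heC : ∀ r, e (MvPolynomial.C r) = Polynomial.C (MvPolynomial.C r) := fun r => by
      simp [e, MvPolynomial.finSuccEquiv_apply]
    have hχ : χ.comp MvPolynomial.C = ψ.comp MvPolynomial.C := by
      ext r
      simp [χ, ← heC]
    rw [← relType_ker_comp_equiv e.symm ψ, relType_ker_polynomial, ih χ (by rwa [hχ]), hχ]
    intro b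
    obtain ⟨r, hr⟩ := hψ b
    exact ⟨MvPolynomial.C r, by rw [← hr, ← hχ]; rfl⟩

/-- **Theorem (invariance of the relation type).** If `R/I ≅ S/J` as `k`-algebras, where
`I ⊆ R = k[x₁,…,xₙ]` and `J ⊆ S = k[y₁,…,y_m]`, then `rt(I) = rt(J)`. -/
theorem relType_invariance {k : Type*} [Field k] {n m : ℕ}
    (I : Ideal (MvPolynomial (Fin n) k)) (J : Ideal (MvPolynomial (Fin m) k))
    (e : (MvPolynomial (Fin n) k ⧸ I) ≃ₐ[k] (MvPolynomial (Fin m) k ⧸ J)) :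
    relType I = relType J := by
  let π₁ : MvPolynomial (Fin n) k →ₐ[k] MvPolynomial (Fin m) k ⧸ J :=
    (e : _ →ₐ[k] _).comp (Ideal.Quotient.mkₐ k I)
  let π₂ : MvPolynomial (Fin m) k →ₐ[k] MvPolynomial (Fin m) k ⧸ J := Ideal.Quotient.mkₐ k J
  have hs₁ : Function.Surjective π₁ := e.surjective.comp Ideal.Quotient.mk_surjective
  have hs₂ : Function.Surjective π₂ := Ideal.Quotient.mk_surjective
  have hk₁ : RingHom.ker π₁.toRingHom = I := by
    ext x
    simp [π₁, RingHom.mem_ker, Ideal.Quotient.eq_zero_iff_mem]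
  have hk₂ : RingHom.ker π₂.toRingHom = J := Ideal.mk_ker
  let ψ : MvPolynomial (Fin m) (MvPolynomial (Fin n) k) →+* MvPolynomial (Fin m) k ⧸ J :=
    MvPolynomial.eval₂Hom π₁.toRingHom fun j => π₂ (MvPolynomial.X j)
  let c := (MvPolynomial.commAlgEquiv k (Fin n) (Fin m)).toRingEquiv
  have h₁ : ψ.comp MvPolynomial.C = π₁.toRingHom := by
    ext <;> simp [ψ]
  have h₂ : (ψ.comp (c : MvPolynomial (Fin n) (MvPolynomial (Fin m) k) →+*
      MvPolynomial (Fin m) (MvPolynomial (Fin n) k))).comp MvPolynomial.C = π₂.toRingHom := by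
    refine MvPolynomial.ringHom_ext (fun r => ?_) fun j => ?_ <;>
    simp [ψ, c]
  calc relType I = relType (RingHom.ker (ψ.comp MvPolynomial.C)) := by rw [h₁, hk₁]
    _ = relType (RingHom.ker ψ) := (relType_ker_mvPolynomial m ψ (by rw [h₁]; exact hs₁)).symm
    _ = _ := (relType_ker_comp_equiv c ψ).symm
    _ = _ := relType_ker_mvPolynomial n _ (by rw [h₂]; exact hs₂)
    _ = relType J := by rw [h₂, hk₂]
end

section
/- Let k be a field, let I be an ideal of R = k[x_1,…,x_n] and J an ideal of S = k[y_1,…,y_m], and suppose there is an isomorphism of k-algebras R/I ≅ S/J. Then there exists a graded isomorphism of rings G(I)[y_1,…,y_m] ≅ G(J)[x_1,…,x_n], where G(I) = ⊕_{q≥0} I^q/I^{q+1} and G(J) = ⊕_{q≥0} J^q/J^{q+1} are the associated graded rings of I and J, and the adjoined variables are given degree 1. -/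
open Polynomial MvPolynomial

/-- The ideal `I·𝐑(I)` of the Rees algebra `𝐑(I) ⊆ R[X]` of an ideal `I ⊆ R`. -/
noncomputable def agIdeal {R : Type*} [CommRing R] (I : Ideal R) : Ideal (reesAlgebra I) :=
  Ideal.map (algebraMap R (reesAlgebra I)) I

/-- The associated graded ring `G(I) = 𝐑(I)/I·𝐑(I) = ⊕_{q≥0} I^q/I^{q+1}` of an ideal `I`. -/
abbrev AssocGraded {R : Type*} [CommRing R] (I : Ideal R) : Type _ :=
  reesAlgebra I ⧸ agIdeal I

/-- The homogeneous component of degree `q` of `G(I)`, namely the image `I^q/I^{q+1}`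
of the degree-`q` component `I^q·X^q` of the Rees algebra. -/
noncomputable def agPiece {R : Type*} [CommRing R] (I : Ideal R) (q : ℕ) :
    Set (AssocGraded I) :=
  {a | ∃ (r : R) (hr : r ∈ I ^ q) (h : (Polynomial.C r * Polynomial.X ^ q : R[X]) ∈ reesAlgebra I),
    a = Ideal.Quotient.mk (agIdeal I) ⟨Polynomial.C r * Polynomial.X ^ q, h⟩}

/-- The homogeneous component of degree `d` of the polynomial ring `G(I)[y₁,…,y_m]`, where each
adjoined variable `y_j` is given degree `1` and `G(I)` carries its natural grading: the additive
subgroup generated by the monomials `c·y^α` with `c ∈ G(I)` homogeneous of degree `q` and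
`q + |α| = d`. -/
noncomputable def agPolyPiece {R : Type*} [CommRing R] (I : Ideal R) (m : ℕ) (d : ℕ) :
    AddSubgroup (MvPolynomial (Fin m) (AssocGraded I)) :=
  AddSubgroup.closure {P | ∃ (q : ℕ) (α : Fin m →₀ ℕ) (c : AssocGraded I),
    c ∈ agPiece I q ∧ q + α.sum (fun _ e => e) = d ∧ P = MvPolynomial.monomial α c}

section AssocGraded

variable {R S : Type*} [CommRing R] [CommRing S]

/-- The additive map sending `r ∈ I ^ q` to its class in degree `q` of `G(I)`. -/
noncomputable def agSymbol (I : Ideal R) (q : ℕ) : ↥(I ^ q) →+ AssocGraded I where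
  toFun r := Ideal.Quotient.mk (agIdeal I)
    ⟨Polynomial.monomial q (r : R), reesAlgebra.monomial_mem.2 r.2⟩
  map_zero' := by
    rw [Ideal.Quotient.eq_zero_iff_mem]
    convert (agIdeal I).zero_mem
    simp
  map_add' r s := by
    rw [← map_add]
    congr 1
    exact Subtype.ext (by simp)

theorem agSymbol_mul (I : Ideal R) {p q : ℕ} (r : ↥(I ^ p)) (s : ↥(I ^ q)) :
    agSymbol I p r * agSymbol I q s =
      agSymbol I (p + q) ⟨r * s, by rw [pow_add]; exact Ideal.mul_mem_mul r.2 s.2⟩ := by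
  simp only [agSymbol, AddMonoidHom.coe_mk, ZeroHom.coe_mk, ← map_mul]
  congr 1
  exact Subtype.ext (Polynomial.monomial_mul_monomial _ _ _ _)

theorem agSymbol_congr (I : Ideal R) {p q : ℕ} (h : p = q) {r s : R} (hrs : r = s)
    (hr : r ∈ I ^ p) (hs : s ∈ I ^ q) : agSymbol I p ⟨r, hr⟩ = agSymbol I q ⟨s, hs⟩ := by
  subst h hrs
  rfl

theorem agSymbol_one (I : Ideal R) : agSymbol I 0 ⟨1, by simp⟩ = 1 := by
  simp only [agSymbol, AddMonoidHom.coe_mk, ZeroHom.coe_mk]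
  rw [← map_one (Ideal.Quotient.mk (agIdeal I))]
  rfl

theorem agSymbol_pow (I : Ideal R) {p : ℕ} (r : ↥(I ^ p)) (q : ℕ) :
    agSymbol I p r ^ q =
      agSymbol I (p * q) ⟨r ^ q, by rw [pow_mul]; exact Ideal.pow_mem_pow r.2 q⟩ := by
  simp only [agSymbol, AddMonoidHom.coe_mk, ZeroHom.coe_mk, ← map_pow]
  congr 1
  exact Subtype.ext (by simp [Polynomial.monomial_pow])

theorem agSymbol_eq_zero (I : Ideal R) {q : ℕ} {r : R} (hr : r ∈ I ^ q) (h : r ∈ I ^ (q + 1)) :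
    agSymbol I q ⟨r, hr⟩ = 0 := by
  suffices ∃ h' : r ∈ I ^ q, agSymbol I q ⟨r, h'⟩ = 0 from this.2
  clear hr
  rw [pow_succ'] at h
  induction h using Submodule.mul_induction_on' with
  | mem_mul_mem a ha b hb =>
    refine ⟨Ideal.mul_mem_left _ _ hb, Ideal.Quotient.eq_zero_iff_mem.2 ?_⟩
    have key := Ideal.mul_mem_right (⟨Polynomial.monomial q b, reesAlgebra.monomial_mem.2 hb⟩ :
      reesAlgebra I) _ (Ideal.mem_map_of_mem (algebraMap R (reesAlgebra I)) ha)
    have hab : algebraMap R (reesAlgebra I) a *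
        ⟨Polynomial.monomial q b, reesAlgebra.monomial_mem.2 hb⟩ =
        ⟨Polynomial.monomial q (a * b), reesAlgebra.monomial_mem.2 (Ideal.mul_mem_left _ _ hb)⟩ :=
      Subtype.ext (Polynomial.C_mul_monomial (R := R))
    rwa [hab] at key
  | add x _ y _ hx hy =>
    obtain ⟨hx', hx⟩ := hx
    obtain ⟨hy', hy⟩ := hy
    refine ⟨add_mem hx' hy', ?_⟩
    have := map_add (agSymbol I q) ⟨x, hx'⟩ ⟨y, hy'⟩
    rwa [hx, hy, add_zero] at this

theorem coeff_mem_of_mem_agIdeal {I : Ideal R} {F : reesAlgebra I} (hF : F ∈ agIdeal I) (q : ℕ) :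
    (F : R[X]).coeff q ∈ I ^ (q + 1) := by
  induction hF using Submodule.span_induction generalizing q with
  | mem F hF =>
    obtain ⟨a, ha, rfl⟩ := hF
    change (Polynomial.C a).coeff q ∈ _
    rw [Polynomial.coeff_C]
    split_ifs with h
    · simpa [h] using ha
    · exact zero_mem _
  | zero => simp
  | add F G _ _ hF hG => simpa using add_mem (hF q) (hG q)
  | smul G F _ hF =>
    change ((G : R[X]) * F).coeff q ∈ _
    rw [Polynomial.coeff_mul]
    refine Ideal.sum_mem _ fun x hx => ?_
    rw [← Finset.HasAntidiagonal.mem_antidiagonal.mp hx, add_assoc, pow_add]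
    exact Ideal.mul_mem_mul (G.2 _) (hF _)

theorem eq_sum_monomial {I : Ideal R} (F : reesAlgebra I) :
    F = ∑ q ∈ (F : R[X]).support, (⟨Polynomial.monomial q ((F : R[X]).coeff q),
      reesAlgebra.monomial_mem.2 (F.2 q)⟩ : reesAlgebra I) := by
  apply Subtype.ext
  rw [AddSubmonoidClass.coe_finsetSum]
  exact (F : R[X]).as_sum_support

theorem agSymbol_induction {I : Ideal R} {N : AddSubgroup (AssocGraded I)}
    (hN : ∀ q r, agSymbol I q r ∈ N) (a : AssocGraded I) : a ∈ N := by
  obtain ⟨F, rfl⟩ := Ideal.Quotient.mk_surjective a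
  rw [eq_sum_monomial F, map_sum]
  exact sum_mem fun q _ => hN q ⟨_, F.2 q⟩

theorem agSymbol_hom_ext {I : Ideal R} {M : Type*} [AddCommGroup M] {f g : AssocGraded I →+ M}
    (h : ∀ q r, f (agSymbol I q r) = g (agSymbol I q r)) (a : AssocGraded I) : f a = g a :=
  agSymbol_induction (N := AddMonoidHom.eqLocus f g) h a

theorem mem_agPiece_iff {I : Ideal R} {q : ℕ} {a : AssocGraded I} :
    a ∈ agPiece I q ↔ a ∈ (agSymbol I q).range := by
  constructor
  · rintro ⟨r, hr, h, rfl⟩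
    refine ⟨⟨r, hr⟩, ?_⟩
    simp only [agSymbol, AddMonoidHom.coe_mk, ZeroHom.coe_mk, Polynomial.C_mul_X_pow_eq_monomial]
  · rintro ⟨⟨r, hr⟩, rfl⟩
    refine ⟨r, hr, ?_, ?_⟩
    · rw [Polynomial.C_mul_X_pow_eq_monomial]
      exact reesAlgebra.monomial_mem.2 hr
    · simp only [agSymbol, AddMonoidHom.coe_mk, ZeroHom.coe_mk, Polynomial.C_mul_X_pow_eq_monomial]

theorem map_mem_pow {I : Ideal R} {J : Ideal S} {f : R →+* S} (h : I ≤ J.comap f) {q : ℕ} {r : R}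
    (hr : r ∈ I ^ q) : f r ∈ J ^ q :=
  (Ideal.pow_right_mono h q).trans (Ideal.le_comap_pow f q) hr

/-- The map on Rees algebras induced by a ring homomorphism `f` with `f(I) ⊆ J`. -/
noncomputable def reesMap {I : Ideal R} {J : Ideal S} (f : R →+* S) (h : I ≤ J.comap f) :
    reesAlgebra I →+* reesAlgebra J :=
  ((Polynomial.mapRingHom f).comp (reesAlgebra I).val.toRingHom).codRestrict (reesAlgebra J)
    fun F q => by
      simpa using map_mem_pow h (F.2 q)

/-- The map on associated graded rings induced by a ring homomorphism `f` with `f(I) ⊆ J`. -/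
noncomputable def agMap {I : Ideal R} {J : Ideal S} (f : R →+* S) (h : I ≤ J.comap f) :
    AssocGraded I →+* AssocGraded J :=
  Ideal.quotientMap (agIdeal J) (reesMap f h) <| by
    refine Ideal.map_le_iff_le_comap.2 fun r hr => ?_
    rw [Ideal.mem_comap, Ideal.mem_comap]
    have hr' : reesMap f h (algebraMap R (reesAlgebra I) r) = algebraMap S (reesAlgebra J) (f r) :=
      Subtype.ext (Polynomial.map_C (R := R) f)
    rw [hr']
    exact Ideal.mem_map_of_mem _ (h hr)

theorem agMap_agSymbol {I : Ideal R} {J : Ideal S} (f : R →+* S) (h : I ≤ J.comap f) {q : ℕ}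
    (r : ↥(I ^ q)) : agMap f h (agSymbol I q r) = agSymbol J q ⟨f r, map_mem_pow h r.2⟩ :=
  congrArg (Ideal.Quotient.mk (agIdeal J)) (Subtype.ext (Polynomial.map_monomial (R := R) f))

theorem agMap_agMap {I : Ideal R} {J : Ideal S} (f : R →+* S) (h : I ≤ J.comap f)
    (g : S →+* R) (h' : J ≤ I.comap g) (hgf : ∀ r, g (f r) = r) (a : AssocGraded I) :
    agMap g h' (agMap f h a) = a := by
  refine agSymbol_hom_ext (f := ((agMap g h').comp (agMap f h)).toAddMonoidHom)
    (g := AddMonoidHom.id _) (fun q r => ?_) a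
  simp [agMap_agSymbol, hgf]

/-- The isomorphism of associated graded rings induced by a ring isomorphism `φ` with
`φ(I) = J`. -/
noncomputable def agEquiv {I : Ideal R} {J : Ideal S} (φ : R ≃+* S)
    (h : J.comap φ.toRingHom = I) : AssocGraded I ≃+* AssocGraded J :=
  RingEquiv.ofRingHom (agMap φ.toRingHom h.ge)
    (agMap φ.symm.toRingHom fun s hs => by
      rw [Ideal.mem_comap, ← h, Ideal.mem_comap]
      simpa using hs)
    (RingHom.ext fun a => agMap_agMap _ _ _ _ (by simp) a)
    (RingHom.ext fun a => agMap_agMap _ _ _ _ (by simp) a)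

theorem agEquiv_agSymbol {I : Ideal R} {J : Ideal S} (φ : R ≃+* S)
    (h : J.comap φ.toRingHom = I) {q : ℕ} (r : ↥(I ^ q)) :
    agEquiv φ h (agSymbol I q r) = agSymbol J q ⟨φ r, map_mem_pow h.ge r.2⟩ :=
  agMap_agSymbol _ _ r

theorem map_agEquiv_range_agSymbol {I : Ideal R} {J : Ideal S} (φ : R ≃+* S)
    (h : J.comap φ.toRingHom = I) (q : ℕ) :
    (agSymbol I q).range.map (agEquiv φ h).toRingHom.toAddMonoidHom = (agSymbol J q).range := by
  ext b
  constructor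
  · rintro ⟨_, ⟨r, rfl⟩, rfl⟩
    exact ⟨_, (agEquiv_agSymbol φ h r).symm⟩
  · rintro ⟨s, rfl⟩
    have hs : φ.symm s ∈ I ^ q :=
      map_mem_pow (f := φ.symm.toRingHom) (fun s hs => by
        rw [Ideal.mem_comap, ← h, Ideal.mem_comap]
        simpa using hs) s.2
    refine ⟨_, ⟨⟨_, hs⟩, rfl⟩, (agEquiv_agSymbol φ h _).trans ?_⟩
    exact agSymbol_congr J rfl (by simp) _ _

/-- The ideal of `R[Y]` generated by `I` and the variables: the polynomials whose constant
coefficient lies in `I`. -/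
noncomputable def extendByVars (I : Ideal R) (σ : Type*) : Ideal (MvPolynomial σ R) :=
  I.comap MvPolynomial.constantCoeff

variable {σ : Type*}

theorem le_comap_C_extendByVars (I : Ideal R) (σ : Type*) :
    I ≤ (extendByVars I σ).comap MvPolynomial.C := fun r hr => by
  simpa [extendByVars] using hr

theorem X_mem_extendByVars_pow_one (I : Ideal R) (j : σ) :
    (MvPolynomial.X j : MvPolynomial σ R) ∈ extendByVars I σ ^ 1 := by
  simp [extendByVars]

theorem monomial_one_mem_extendByVars_pow (I : Ideal R) (α : σ →₀ ℕ) :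
    MvPolynomial.monomial α (1 : R) ∈ extendByVars I σ ^ α.degree := by
  induction α using Finsupp.induction_linear with
  | zero => simp
  | add α β hα hβ =>
    rw [← one_mul (1 : R), ← MvPolynomial.monomial_mul, map_add, pow_add]
    exact Ideal.mul_mem_mul hα hβ
  | single j e =>
    rw [← MvPolynomial.X_pow_eq_monomial, Finsupp.degree_single]
    exact Ideal.pow_mem_pow (by simp [extendByVars]) e

theorem monomial_mem_extendByVars_pow {I : Ideal R} {q : ℕ} {r : R} (hr : r ∈ I ^ q)
    (α : σ →₀ ℕ) : MvPolynomial.monomial α r ∈ extendByVars I σ ^ (q + α.degree) := by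
  rw [← mul_one r, ← MvPolynomial.C_mul_monomial, pow_add]
  exact Ideal.mul_mem_mul (map_mem_pow (le_comap_C_extendByVars I σ) hr)
    (monomial_one_mem_extendByVars_pow I α)

theorem coeff_mem_of_mem_extendByVars_pow {I : Ideal R} {d : ℕ} {f : MvPolynomial σ R}
    (hf : f ∈ extendByVars I σ ^ d) (α : σ →₀ ℕ) : f.coeff α ∈ I ^ (d - α.degree) := by
  classical
  induction d generalizing f α with
  | zero => simp
  | succ d ih =>
    rw [pow_succ'] at hf
    induction hf using Submodule.mul_induction_on' with
    | mem_mul_mem a ha b hb =>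
      rw [MvPolynomial.coeff_mul]
      refine Ideal.sum_mem _ fun x hx => ?_
      rw [← Finset.HasAntidiagonal.mem_antidiagonal.mp hx, map_add]
      by_cases h : x.1 = 0
      · refine Ideal.pow_le_pow_right (n := 1 + (d - x.2.degree)) (by simp [h]; omega) ?_
        rw [pow_add, pow_one]
        refine Ideal.mul_mem_mul ?_ (ih hb x.2)
        rw [h]
        exact ha
      · have : x.1.degree ≠ 0 := by rwa [Ne, Finsupp.degree_eq_zero_iff]
        exact Ideal.mul_mem_left _ _ (Ideal.pow_le_pow_right (by omega) (ih hb x.2))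
    | add x _ y _ hx hy => simpa using add_mem hx hy

/-- The polynomial whose coefficient in degree `q` is the coefficient of `Y ^ α` in the coefficient
of `F` in degree `q + |α|`. -/
noncomputable def shiftCoeff (α : σ →₀ ℕ) (F : (MvPolynomial σ R)[X]) : R[X] :=
  ∑ q ∈ Finset.range (F.natDegree + 1), Polynomial.monomial q ((F.coeff (q + α.degree)).coeff α)

theorem coeff_shiftCoeff (α : σ →₀ ℕ) (F : (MvPolynomial σ R)[X]) (q : ℕ) :
    (shiftCoeff α F).coeff q = (F.coeff (q + α.degree)).coeff α := by
  simp only [shiftCoeff, Polynomial.finsetSum_coeff, Polynomial.coeff_monomial,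
    Finset.sum_ite_eq', Finset.mem_range]
  split_ifs with h
  · rfl
  · rw [Polynomial.coeff_eq_zero_of_natDegree_lt (by omega), MvPolynomial.coeff_zero]

/-- The additive map on Rees algebras induced by `shiftCoeff`. -/
noncomputable def reesCoeff (I : Ideal R) (α : σ →₀ ℕ) :
    reesAlgebra (extendByVars I σ) →+ reesAlgebra I where
  toFun F := ⟨shiftCoeff α (F : (MvPolynomial σ R)[X]), fun q => by
    rw [coeff_shiftCoeff]
    simpa using coeff_mem_of_mem_extendByVars_pow (F.2 (q + α.degree)) α⟩
  map_zero' := Subtype.ext <| Polynomial.ext fun q => by simp [coeff_shiftCoeff]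
  map_add' F G := Subtype.ext <| Polynomial.ext fun q => by simp [coeff_shiftCoeff]

theorem mem_agIdeal_of_coeff_mem {I : Ideal R} {F : reesAlgebra I}
    (hF : ∀ q, (F : R[X]).coeff q ∈ I ^ (q + 1)) : F ∈ agIdeal I := by
  rw [← Ideal.Quotient.eq_zero_iff_mem, eq_sum_monomial F, map_sum]
  exact Finset.sum_eq_zero fun q _ => agSymbol_eq_zero I (F.2 q) (hF q)

/-- The additive map `G(I + (Y)) → G(I)` extracting the coefficient of `Y ^ α`. -/
noncomputable def agCoeff (I : Ideal R) (α : σ →₀ ℕ) :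
    AssocGraded (extendByVars I σ) →+ AssocGraded I :=
  QuotientAddGroup.map (agIdeal (extendByVars I σ)).toAddSubgroup (agIdeal I).toAddSubgroup
    (reesCoeff I α) fun F hF => mem_agIdeal_of_coeff_mem fun q => by
      change (shiftCoeff α (F : (MvPolynomial σ R)[X])).coeff q ∈ _
      rw [coeff_shiftCoeff]
      convert coeff_mem_of_mem_extendByVars_pow
        (coeff_mem_of_mem_agIdeal hF (q + α.degree)) α using 2
      omega

theorem agCoeff_agSymbol_monomial [DecidableEq σ] {I : Ideal R} (α β : σ →₀ ℕ) {q : ℕ} {r : R}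
    (hr : r ∈ I ^ q) :
    agCoeff I β (agSymbol (extendByVars I σ) (q + α.degree)
      ⟨MvPolynomial.monomial α r, monomial_mem_extendByVars_pow hr α⟩) =
      if α = β then agSymbol I q ⟨r, hr⟩ else 0 := by
  change Ideal.Quotient.mk (agIdeal I) (reesCoeff I β _) = _
  split_ifs with h
  · subst h
    refine congrArg (Ideal.Quotient.mk (agIdeal I)) (Subtype.ext <| Polynomial.ext fun p => ?_)
    refine (coeff_shiftCoeff _ _ _).trans ?_
    simp only [Polynomial.coeff_monomial, add_left_inj]
    split_ifs <;> simp
  · rw [← map_zero (Ideal.Quotient.mk (agIdeal I))]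
    refine congrArg (Ideal.Quotient.mk (agIdeal I)) (Subtype.ext <| Polynomial.ext fun p => ?_)
    refine (coeff_shiftCoeff _ _ _).trans ?_
    simp only [Polynomial.coeff_monomial]
    split_ifs <;> simp [h]

/-- The ring homomorphism `G(I)[Y] → G(I + (Y))` sending each variable to its class in degree
one. -/
noncomputable def agExtendHom (I : Ideal R) (σ : Type*) :
    MvPolynomial σ (AssocGraded I) →+* AssocGraded (extendByVars I σ) :=
  MvPolynomial.eval₂Hom (R := AssocGraded I) (S₁ := AssocGraded (extendByVars I σ))
    (agMap (J := extendByVars I σ) MvPolynomial.C (le_comap_C_extendByVars I σ)) fun j =>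
    agSymbol (extendByVars I σ) 1 ⟨MvPolynomial.X j, X_mem_extendByVars_pow_one I j⟩

theorem agExtendHom_monomial_one (I : Ideal R) (α : σ →₀ ℕ) :
    agExtendHom I σ (MvPolynomial.monomial α 1) = agSymbol (extendByVars I σ) α.degree
      ⟨MvPolynomial.monomial α 1, monomial_one_mem_extendByVars_pow I α⟩ := by
  induction α using Finsupp.induction_linear with
  | zero =>
    refine (map_one _).trans ((agSymbol_one _).symm.trans ?_)
    exact agSymbol_congr _ (map_zero _).symm rfl _ _
  | add α β hα hβ =>
    rw [← one_mul (1 : AssocGraded I), ← MvPolynomial.monomial_mul, map_mul, hα, hβ, agSymbol_mul]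
    exact agSymbol_congr _ (map_add _ _ _).symm (by simp [MvPolynomial.monomial_mul]) _ _
  | single j e =>
    rw [← MvPolynomial.X_pow_eq_monomial, map_pow, agExtendHom, MvPolynomial.coe_eval₂Hom,
      MvPolynomial.eval₂_X, agSymbol_pow]
    exact agSymbol_congr _ (by simp) (MvPolynomial.X_pow_eq_monomial) _ _

theorem agExtendHom_monomial_agSymbol (I : Ideal R) (α : σ →₀ ℕ) {q : ℕ} {r : R}
    (hr : r ∈ I ^ q) :
    agExtendHom I σ (MvPolynomial.monomial α (agSymbol I q ⟨r, hr⟩)) =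
      agSymbol (extendByVars I σ) (q + α.degree)
        ⟨MvPolynomial.monomial α r, monomial_mem_extendByVars_pow hr α⟩ := by
  rw [← mul_one (agSymbol I q ⟨r, hr⟩), ← MvPolynomial.C_mul_monomial, map_mul,
    agExtendHom_monomial_one, agExtendHom, MvPolynomial.coe_eval₂Hom, MvPolynomial.eval₂_C,
    agMap_agSymbol, agSymbol_mul]
  exact agSymbol_congr _ rfl (by simp [MvPolynomial.C_mul_monomial]) _ _

theorem agCoeff_agExtendHom (I : Ideal R) (β : σ →₀ ℕ) (P : MvPolynomial σ (AssocGraded I)) :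
    agCoeff I β (agExtendHom I σ P) = P.coeff β := by
  classical
  induction P using MvPolynomial.induction_on' with
  | monomial α c =>
    refine agSymbol_hom_ext (f := ((agCoeff I β).comp (agExtendHom I σ).toAddMonoidHom).comp
      (MvPolynomial.monomial α).toAddMonoidHom)
      (g := (MvPolynomial.lcoeff (AssocGraded I) β).toAddMonoidHom.comp
        (MvPolynomial.monomial α).toAddMonoidHom) (fun q r => ?_) c
    refine (congrArg (agCoeff I β) (agExtendHom_monomial_agSymbol I α r.2)).trans ?_
    rw [agCoeff_agSymbol_monomial]
    exact (MvPolynomial.coeff_monomial β α (agSymbol I q r)).symm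
  | add P Q hP hQ => simp [hP, hQ]

theorem agExtendHom_injective (I : Ideal R) (σ : Type*) :
    Function.Injective (agExtendHom I σ) := fun P Q h =>
  MvPolynomial.ext _ _ fun β => by rw [← agCoeff_agExtendHom, h, agCoeff_agExtendHom]

theorem map_agExtendHom_agPolyPiece (I : Ideal R) (m d : ℕ) :
    (agPolyPiece I m d).map (agExtendHom I (Fin m)).toAddMonoidHom =
      (agSymbol (extendByVars I (Fin m)) d).range := by
  apply le_antisymm
  · rw [agPolyPiece, AddSubgroup.map_le_iff_le_comap, AddSubgroup.closure_le]
    rintro _ ⟨q, α, c, hc, hd, rfl⟩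
    obtain ⟨r, rfl⟩ := mem_agPiece_iff.1 hc
    have hd : q + α.degree = d := hd
    subst hd
    exact ⟨_, (agExtendHom_monomial_agSymbol I α r.2).symm⟩
  · rintro _ ⟨⟨f, hf⟩, rfl⟩
    have hmem (α) : MvPolynomial.monomial α (f.coeff α) ∈ extendByVars I (Fin m) ^ d :=
      Ideal.pow_le_pow_right (by omega)
        (monomial_mem_extendByVars_pow (coeff_mem_of_mem_extendByVars_pow hf α) α)
    have hsum : (⟨f, hf⟩ : ↥(extendByVars I (Fin m) ^ d)) = ∑ α ∈ f.support, ⟨_, hmem α⟩ := by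
      apply Subtype.ext
      rw [AddSubmonoidClass.coe_finsetSum]
      exact f.as_sum
    rw [hsum, map_sum]
    refine sum_mem fun α _ => ?_
    by_cases h : α.degree ≤ d
    · have hα := coeff_mem_of_mem_extendByVars_pow hf α
      refine ⟨MvPolynomial.monomial α (agSymbol I (d - α.degree) ⟨f.coeff α, hα⟩),
        AddSubgroup.subset_closure ⟨d - α.degree, α, _, mem_agPiece_iff.2 ⟨_, rfl⟩,
          Nat.sub_add_cancel h, rfl⟩, ?_⟩
      refine (agExtendHom_monomial_agSymbol I α hα).trans ?_
      exact agSymbol_congr _ (Nat.sub_add_cancel h) rfl _ _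
    · rw [agSymbol_eq_zero]
      · exact zero_mem _
      · refine Ideal.pow_le_pow_right (by omega) (monomial_mem_extendByVars_pow (q := 0) ?_ α)
        simp

theorem agExtendHom_surjective (I : Ideal R) (m : ℕ) :
    Function.Surjective (agExtendHom I (Fin m)) := fun a => by
  suffices a ∈ (⊤ : AddSubgroup (MvPolynomial (Fin m) (AssocGraded I))).map
      (agExtendHom I (Fin m)).toAddMonoidHom by
    obtain ⟨P, -, hP⟩ := this
    exact ⟨P, hP⟩
  refine agSymbol_induction (fun q r => ?_) a
  have hr : agSymbol _ q r ∈ (agSymbol (extendByVars I (Fin m)) q).range := ⟨r, rfl⟩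
  rw [← map_agExtendHom_agPolyPiece] at hr
  obtain ⟨P, -, hP⟩ := hr
  exact ⟨P, trivial, hP⟩

/-- The isomorphism `G(I)[Y] ≃ G(I + (Y))`. -/
noncomputable def agExtendEquiv (I : Ideal R) (m : ℕ) :
    MvPolynomial (Fin m) (AssocGraded I) ≃+* AssocGraded (extendByVars I (Fin m)) :=
  RingEquiv.ofBijective (agExtendHom I (Fin m))
    ⟨agExtendHom_injective I _, agExtendHom_surjective I m⟩

/-- The automorphism of `R[Y]` translating the variables by `f`. -/
noncomputable def translateVars (f : σ → R) : MvPolynomial σ R ≃ₐ[R] MvPolynomial σ R :=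
  AlgEquiv.ofAlgHom
    (MvPolynomial.aeval fun j => MvPolynomial.X j - MvPolynomial.C (f j))
    (MvPolynomial.aeval fun j => MvPolynomial.X j + MvPolynomial.C (f j))
    (by ext; simp [← MvPolynomial.algebraMap_eq]) (by ext; simp [← MvPolynomial.algebraMap_eq])

theorem eval_translateVars (f : σ → R) (p : MvPolynomial σ R) :
    MvPolynomial.eval f (translateVars f p) = MvPolynomial.constantCoeff p := by
  suffices (MvPolynomial.eval f).comp (translateVars f).toRingEquiv.toRingHom =
    MvPolynomial.constantCoeff from RingHom.congr_fun this p
  ext <;> simp [translateVars]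

end AssocGraded

/-- If `R/I ≅ S/J` as `k`-algebras, where `I ⊆ R = k[x₁,…,xₙ]` and `J ⊆ S = k[y₁,…,y_m]`, then
there is a graded isomorphism of rings `G(I)[y₁,…,y_m] ≅ G(J)[x₁,…,xₙ]`, the adjoined
variables being given degree `1`. -/
theorem assocGraded_poly_iso {k : Type*} [Field k] {n m : ℕ}
    (I : Ideal (MvPolynomial (Fin n) k)) (J : Ideal (MvPolynomial (Fin m) k))
    (e : (MvPolynomial (Fin n) k ⧸ I) ≃ₐ[k] (MvPolynomial (Fin m) k ⧸ J)) :
    ∃ Φ : MvPolynomial (Fin m) (AssocGraded I) ≃+* MvPolynomial (Fin n) (AssocGraded J),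
      ∀ d : ℕ,
        (agPolyPiece I m d).map Φ.toRingHom.toAddMonoidHom = agPolyPiece J n d := by
  choose f hf using fun j => Ideal.Quotient.mk_surjective (e.symm (Ideal.Quotient.mk J (.X j)))
  choose g hg using fun i => Ideal.Quotient.mk_surjective (e (Ideal.Quotient.mk I (.X i)))
  let swap := MvPolynomial.commAlgEquiv k (Fin m) (Fin n)
  have hswap (p) : e (Ideal.Quotient.mk I (MvPolynomial.eval f p)) =
      Ideal.Quotient.mk J (MvPolynomial.eval g (swap p)) := by
    suffices (e : _ →+* _).comp ((Ideal.Quotient.mk I).comp (MvPolynomial.eval f)) =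
        (Ideal.Quotient.mk J).comp ((MvPolynomial.eval g).comp (swap : _ →+* _)) from
      RingHom.congr_fun this p
    ext a
    · simp only [swap, RingHom.comp_apply, MvPolynomial.eval_C, RingHom.coe_coe,
        MvPolynomial.commAlgEquiv_C, MvPolynomial.map_C]
      exact e.commutes a
    · simp [swap, hg]
    · simp [swap, hf]
  let φ : MvPolynomial (Fin m) (MvPolynomial (Fin n) k) ≃+*
      MvPolynomial (Fin n) (MvPolynomial (Fin m) k) :=
    ((translateVars f).toRingEquiv.trans swap.toRingEquiv).trans (translateVars g).symm.toRingEquiv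
  have hφ : (extendByVars J (Fin n)).comap φ.toRingHom = extendByVars I (Fin m) := by
    ext p
    have hp : MvPolynomial.constantCoeff (φ p) =
        MvPolynomial.eval g (swap (translateVars f p)) := by
      rw [← eval_translateVars g]
      simp [φ]
    change MvPolynomial.constantCoeff (φ p) ∈ J ↔ MvPolynomial.constantCoeff p ∈ I
    rw [hp, ← eval_translateVars f, ← Ideal.Quotient.eq_zero_iff_mem, ← hswap,
      EmbeddingLike.map_eq_zero_iff, Ideal.Quotient.eq_zero_iff_mem]
  refine ⟨((agExtendEquiv I m).trans (agEquiv φ hφ)).trans (agExtendEquiv J n).symm, fun d => ?_⟩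
  have hJ : (agPolyPiece J n d).map (agExtendEquiv J n).toRingHom.toAddMonoidHom =
      (agSymbol (extendByVars J (Fin n)) d).range := map_agExtendHom_agPolyPiece J n d
  have hI : (agPolyPiece I m d).map (agExtendEquiv I m).toRingHom.toAddMonoidHom =
      (agSymbol (extendByVars I (Fin m)) d).range := map_agExtendHom_agPolyPiece I m d
  have hinj : Function.Injective (agExtendEquiv J n).toRingHom.toAddMonoidHom :=
    (agExtendEquiv J n).injective
  apply AddSubgroup.map_injective hinj
  rw [hJ, ← map_agEquiv_range_agSymbol φ hφ, ← hI, AddSubgroup.map_map, AddSubgroup.map_map]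
  congr 1
  ext P
  simp
end

section
/- Let R = ℂ[x,y]/(x³−y²) be the coordinate ring of Neile's semicubical parabola, and write x̄, ȳ for the classes of x and y in R. Let 𝔪 = (x̄−1, ȳ−1) and 𝔫 = (x̄, ȳ), the maximal ideals of R corresponding to the regular point (1,1) and to the origin respectively. Then rt(𝔪) = 1 while rt(𝔫) = 2. -/
open Polynomial MvPolynomial

section ReesGeneral

variable {R : Type*} [CommRing R]

theorem mem_reesKer {s : ℕ} {f : Fin s → R} {p : MvPolynomial (Fin s) R} :
    p ∈ reesKer f ↔
      MvPolynomial.aeval (fun i => Polynomial.C (f i) * Polynomial.X) p = (0 : Polynomial R) :=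
  Iff.rfl

theorem genInDegLE_iff_le {s : ℕ} {L : Ideal (MvPolynomial (Fin s) R)} {N : ℕ} :
    GenInDegLE L N ↔ L ≤ Ideal.span {p | p ∈ L ∧ ∃ q ≤ N, MvPolynomial.IsHomogeneous p q} :=
  ⟨fun h => h.le, fun h => le_antisymm h (Ideal.span_le.2 fun _ hp => hp.1)⟩

/-- Replacing each variable by a linear form. -/
noncomputable def linearSubst {s r : ℕ} (a : Fin s → Fin r → R) :
    MvPolynomial (Fin s) R →ₐ[R] MvPolynomial (Fin r) R :=
  MvPolynomial.aeval fun i => ∑ j, MvPolynomial.C (a i j) * MvPolynomial.X j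

theorem linearSubst_X_isHomogeneous {s r : ℕ} (a : Fin s → Fin r → R) (i : Fin s) :
    (linearSubst a (MvPolynomial.X i)).IsHomogeneous 1 := by
  rw [linearSubst, MvPolynomial.aeval_X]
  exact MvPolynomial.IsHomogeneous.sum _ _ _ fun j _ => MvPolynomial.isHomogeneous_C_mul_X _ _

theorem linearSubst_isHomogeneous {s r : ℕ} (a : Fin s → Fin r → R)
    {p : MvPolynomial (Fin s) R} {n : ℕ} (hp : p.IsHomogeneous n) :
    (linearSubst a p).IsHomogeneous n := by
  have h := hp.aeval (fun i => ∑ j, MvPolynomial.C (a i j) * MvPolynomial.X j) (n := 1) fun i =>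
    MvPolynomial.IsHomogeneous.sum _ _ _ fun j _ =>
      MvPolynomial.isHomogeneous_C_mul_X (a i j) j
  simpa [linearSubst] using h

theorem aeval_linearSubst {s r : ℕ} {f : Fin s → R} {g : Fin r → R} {a : Fin s → Fin r → R}
    (ha : ∀ i, f i = ∑ j, a i j * g j) (p : MvPolynomial (Fin s) R) :
    MvPolynomial.aeval (fun j => Polynomial.C (g j) * Polynomial.X) (linearSubst a p) =
      (MvPolynomial.aeval (fun i => Polynomial.C (f i) * Polynomial.X) p : Polynomial R) := by
  rw [← AlgHom.comp_apply]
  congr 1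
  refine MvPolynomial.algHom_ext fun i => ?_
  simp [linearSubst, ha i, Finset.sum_mul, mul_assoc, Polynomial.algebraMap_eq]

theorem exists_linear_of_span_le {s r : ℕ} {f : Fin s → R} {g : Fin r → R}
    (h : Ideal.span (Set.range f) ≤ Ideal.span (Set.range g)) :
    ∃ a : Fin s → Fin r → R, ∀ i, f i = ∑ j, a i j * g j := by
  have (i : Fin s) : ∃ c : Fin r → R, ∑ j, c j * g j = f i :=
    Ideal.mem_span_range_iff_exists_fun.1 (h (Ideal.subset_span ⟨i, rfl⟩))
  choose a ha using this
  exact ⟨a, fun i => (ha i).symm⟩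

/-- Polynomials congruent modulo `J` on the variables are congruent after substitution. -/
theorem sub_algHom_mem {s : ℕ} (F : MvPolynomial (Fin s) R →ₐ[R] MvPolynomial (Fin s) R)
    (J : Ideal (MvPolynomial (Fin s) R))
    (hJ : ∀ i, MvPolynomial.X i - F (MvPolynomial.X i) ∈ J) (p : MvPolynomial (Fin s) R) :
    p - F p ∈ J := by
  have h : (Ideal.Quotient.mkₐ R J) = (Ideal.Quotient.mkₐ R J).comp F :=
    MvPolynomial.algHom_ext fun i => Ideal.Quotient.eq.2 (hJ i)
  exact Ideal.Quotient.eq.1 (DFunLike.congr_fun h p)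

/-- The degree bound for the equations of the Rees algebra does not depend on the
generating family. -/
theorem GenInDegLE.of_span_eq {s r : ℕ} {f : Fin s → R} {g : Fin r → R} {N : ℕ} (hN : 1 ≤ N)
    (h : Ideal.span (Set.range f) = Ideal.span (Set.range g)) (hg : GenInDegLE (reesKer g) N) :
    GenInDegLE (reesKer f) N := by
  obtain ⟨a, ha⟩ := exists_linear_of_span_le h.le
  obtain ⟨b, hb⟩ := exists_linear_of_span_le h.ge
  rw [genInDegLE_iff_le] at hg ⊢
  intro p hp
  set J := Ideal.span {p | p ∈ reesKer f ∧ ∃ q ≤ N, MvPolynomial.IsHomogeneous p q}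
  have h₁ : p - linearSubst b (linearSubst a p) ∈ J := by
    refine sub_algHom_mem ((linearSubst b).comp (linearSubst a)) J (fun i => ?_) p
    refine Ideal.subset_span ⟨?_, 1, hN, ?_⟩
    · rw [mem_reesKer, map_sub, AlgHom.comp_apply, aeval_linearSubst hb, aeval_linearSubst ha,
        sub_self]
    · exact (MvPolynomial.isHomogeneous_X _ _).sub
        (linearSubst_isHomogeneous _ (linearSubst_X_isHomogeneous _ _))
  have h₂ : linearSubst a p ∈ reesKer g := by
    rw [mem_reesKer, aeval_linearSubst ha]
    exact hp
  have h₃ : reesKer g ≤ J.comap (linearSubst b) := by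
    refine hg.trans (Ideal.span_le.2 ?_)
    rintro u ⟨hu, q, hq, hom⟩
    refine Ideal.subset_span ⟨?_, q, hq, linearSubst_isHomogeneous _ hom⟩
    rw [mem_reesKer, aeval_linearSubst hb]
    exact hu
  simpa using J.add_mem h₁ (h₃ h₂)

theorem relType_eq_sInf_s3 {I : Ideal R} {r : ℕ} (g : Fin r → R)
    (hg : Ideal.span (Set.range g) = I) :
    relType I = sInf {N | 1 ≤ N ∧ GenInDegLE (reesKer g) N} := by
  unfold relType
  congr 1
  ext N
  exact ⟨fun h => ⟨h.1, h.2 r g hg⟩,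
    fun h => ⟨h.1, fun s f hf => h.2.of_span_eq h.1 (hf.trans hg.symm)⟩⟩

/-- If `e f_j ∈ (f_{i₀})` for all `j` and `f_{i₀}` is a nonzerodivisor, then every equation of the
Rees algebra becomes a combination of linear equations after multiplication by a power of `e`. -/
theorem exists_pow_mul_mem_of_locally_principal {s : ℕ} {f : Fin s → R} {i₀ : Fin s} {e : R}
    {c : Fin s → R} (hc : ∀ j, e * f j = c j * f i₀) (hf : f i₀ ∈ nonZeroDivisors R)
    {p : MvPolynomial (Fin s) R} (hp : p ∈ reesKer f) :
    ∃ k : ℕ, MvPolynomial.C (e ^ k) * p ∈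
      Ideal.span {p | p ∈ reesKer f ∧ ∃ q ≤ 1, MvPolynomial.IsHomogeneous p q} := by
  set J := Ideal.span {p | p ∈ reesKer f ∧ ∃ q ≤ 1, MvPolynomial.IsHomogeneous p q}
  have hJL : J ≤ reesKer f := Ideal.span_le.2 fun _ hp => hp.1
  have hlin (j : Fin s) : MvPolynomial.C e * MvPolynomial.X j -
      MvPolynomial.C (c j) * MvPolynomial.X i₀ ∈ J := by
    refine Ideal.subset_span ⟨?_, 1, le_rfl, (MvPolynomial.isHomogeneous_C_mul_X _ _).sub
      (MvPolynomial.isHomogeneous_C_mul_X _ _)⟩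
    have := congrArg Polynomial.C (hc j)
    simp only [mem_reesKer, map_sub, map_mul, MvPolynomial.aeval_X, MvPolynomial.aeval_C,
      Polynomial.algebraMap_eq] at this ⊢
    linear_combination Polynomial.X * this
  have key (p : MvPolynomial (Fin s) R) : ∃ (k : ℕ) (h : Polynomial R),
      MvPolynomial.C (e ^ k) * p - Polynomial.aeval (MvPolynomial.X i₀) h ∈ J := by
    induction p using MvPolynomial.induction_on with
    | C a => exact ⟨0, Polynomial.C a, by simp [MvPolynomial.algebraMap_eq]⟩
    | add p q hp hq =>
      obtain ⟨k, h, hk⟩ := hp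
      obtain ⟨l, g, hl⟩ := hq
      refine ⟨k + l, Polynomial.C (e ^ l) * h + Polynomial.C (e ^ k) * g, ?_⟩
      convert J.add_mem (J.mul_mem_left (MvPolynomial.C (e ^ l)) hk)
        (J.mul_mem_left (MvPolynomial.C (e ^ k)) hl) using 1
      simp only [map_add, map_mul, map_pow, Polynomial.aeval_C, MvPolynomial.algebraMap_eq]
      ring
    | mul_X p j hp =>
      obtain ⟨k, h, hk⟩ := hp
      refine ⟨k + 1, Polynomial.C (c j) * Polynomial.X * h, ?_⟩
      convert J.add_mem (J.mul_mem_left (MvPolynomial.C e * MvPolynomial.X j) hk)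
        (J.mul_mem_left (Polynomial.aeval (MvPolynomial.X i₀) h) (hlin j)) using 1
      simp only [map_mul, map_pow, Polynomial.aeval_C, Polynomial.aeval_X,
        MvPolynomial.algebraMap_eq]
      ring
  obtain ⟨k, h, hk⟩ := key p
  have hh : Polynomial.aeval (MvPolynomial.X i₀) h ∈ reesKer f := by
    simpa using (reesKer f).sub_mem ((reesKer f).mul_mem_left (MvPolynomial.C (e ^ k)) hp) (hJL hk)
  have h0 : h = 0 := by
    rw [mem_reesKer, ← Polynomial.aeval_algHom_apply, MvPolynomial.aeval_X] at hh
    ext n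
    have := congrArg (Polynomial.coeff · n) hh
    rw [← Polynomial.comp_eq_aeval, Polynomial.comp_C_mul_X_coeff] at this
    simpa using (mem_nonZeroDivisors_iff_right.1 (pow_mem hf n)) _ this
  exact ⟨k, by simpa [h0] using hk⟩

/-- An ideal which is principal, generated by a nonzerodivisor, on each of two comaximal basic
open sets has its Rees algebra defined by linear equations. -/
theorem genInDegLE_one_of_locally_principal {s : ℕ} {f : Fin s → R} {i₀ i₁ : Fin s} {e₀ e₁ : R}
    {c₀ c₁ : Fin s → R} (h₀ : ∀ j, e₀ * f j = c₀ j * f i₀) (h₁ : ∀ j, e₁ * f j = c₁ j * f i₁)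
    (hf₀ : f i₀ ∈ nonZeroDivisors R) (hf₁ : f i₁ ∈ nonZeroDivisors R) (he : IsCoprime e₀ e₁) :
    GenInDegLE (reesKer f) 1 := by
  rw [genInDegLE_iff_le]
  intro p hp
  obtain ⟨k, hk⟩ := exists_pow_mul_mem_of_locally_principal h₀ hf₀ hp
  obtain ⟨l, hl⟩ := exists_pow_mul_mem_of_locally_principal h₁ hf₁ hp
  obtain ⟨u, v, huv⟩ := he.pow (m := k) (n := l)
  have := Ideal.add_mem _ (Ideal.mul_mem_left _ (MvPolynomial.C u) hk)
    (Ideal.mul_mem_left _ (MvPolynomial.C v) hl)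
  rwa [← mul_assoc, ← mul_assoc, ← add_mul, ← map_mul, ← map_mul, ← map_add, huv, map_one,
    one_mul] at this

theorem MvPolynomial.IsHomogeneous.exists_eq_sum_C_mul_X {s : ℕ} {p : MvPolynomial (Fin s) R}
    (hp : p.IsHomogeneous 1) :
    ∃ c : Fin s → R, p = ∑ i, MvPolynomial.C (c i) * MvPolynomial.X i := by
  rw [← MvPolynomial.mem_homogeneousSubmodule, MvPolynomial.homogeneousSubmodule_one_eq_span_X,
    Submodule.mem_span_range_iff_exists_fun] at hp
  obtain ⟨c, hc⟩ := hp
  exact ⟨c, by simp [← hc, MvPolynomial.smul_eq_C_mul]⟩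

end ReesGeneral

section Cusp

theorem eq_zero_of_expand_add {a b : Polynomial ℂ}
    (h : Polynomial.expand ℂ 2 a + Polynomial.expand ℂ 2 b * Polynomial.X ^ 3 = 0) :
    a = 0 ∧ b = 0 := by
  constructor
  · ext n
    have := congrArg (Polynomial.coeff · (n * 2)) h
    simp only [Polynomial.coeff_add, Polynomial.coeff_expand_mul two_pos,
      Polynomial.coeff_mul_X_pow', Polynomial.coeff_zero] at this
    split_ifs at this
    · rw [Polynomial.coeff_expand two_pos, if_neg (by omega)] at this
      simpa using this
    · simpa using this
  · ext n
    have := congrArg (Polynomial.coeff · (n * 2 + 3)) h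
    simp only [Polynomial.coeff_add, Polynomial.coeff_mul_X_pow,
      Polynomial.coeff_expand_mul two_pos, Polynomial.coeff_expand two_pos,
      Polynomial.coeff_zero] at this
    rw [if_neg (by omega)] at this
    simpa using this

/-- `R` is the coordinate ring of the cuspidal cubic `x³ = y²`, presented through its normalization
`φ : x ↦ t², y ↦ t³` and its decomposition `R = ℂ[x] + ℂ[x] y`. -/
structure IsCuspidalCubic {R : Type*} [CommRing R] [Algebra ℂ R] (x y : R)
    (φ : R →ₐ[ℂ] Polynomial ℂ) : Prop where
  rel : x ^ 3 = y ^ 2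
  map_x : φ x = Polynomial.X ^ 2
  map_y : φ y = Polynomial.X ^ 3
  exists_repr (r : R) : ∃ a b : Polynomial ℂ, r = Polynomial.aeval x a + Polynomial.aeval x b * y

namespace IsCuspidalCubic

variable {R : Type*} [CommRing R] [Algebra ℂ R] {x y : R} {φ : R →ₐ[ℂ] Polynomial ℂ}

theorem map_repr (h : IsCuspidalCubic x y φ) (a b : Polynomial ℂ) :
    φ (Polynomial.aeval x a + Polynomial.aeval x b * y) =
      Polynomial.expand ℂ 2 a + Polynomial.expand ℂ 2 b * Polynomial.X ^ 3 := by
  rw [map_add, map_mul, ← Polynomial.aeval_algHom_apply, ← Polynomial.aeval_algHom_apply,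
    h.map_x, h.map_y]
  rfl

theorem repr_eq_zero (h : IsCuspidalCubic x y φ) {a b : Polynomial ℂ}
    (hab : Polynomial.aeval x a + Polynomial.aeval x b * y = 0) : a = 0 ∧ b = 0 :=
  eq_zero_of_expand_add (by rw [← h.map_repr, hab, map_zero])

theorem injective (h : IsCuspidalCubic x y φ) : Function.Injective φ := by
  rw [injective_iff_map_eq_zero]
  intro r hr
  obtain ⟨a, b, rfl⟩ := h.exists_repr r
  rw [h.map_repr] at hr
  obtain ⟨rfl, rfl⟩ := eq_zero_of_expand_add hr
  simp

theorem mem_nonZeroDivisors (h : IsCuspidalCubic x y φ) {r : R} (hr : φ r ≠ 0) :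
    r ∈ nonZeroDivisors R := by
  have : IsDomain R := h.injective.isDomain φ.toRingHom
  exact mem_nonZeroDivisors_of_ne_zero fun h0 => hr (by rw [h0, map_zero])

theorem coeff_one_map (h : IsCuspidalCubic x y φ) (r : R) : (φ r).coeff 1 = 0 := by
  obtain ⟨a, b, rfl⟩ := h.exists_repr r
  rw [h.map_repr, Polynomial.coeff_add, Polynomial.coeff_expand two_pos,
    Polynomial.coeff_mul_X_pow']
  simp

theorem coeff_zero_map_of_syzygy (h : IsCuspidalCubic x y φ) {a b : R} (hab : a * x + b * y = 0) :
    (φ a).coeff 0 = 0 ∧ (φ b).coeff 0 = 0 := by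
  have h' := congrArg φ hab
  simp only [map_add, map_mul, h.map_x, h.map_y, map_zero] at h'
  have h₂ := congrArg (Polynomial.coeff · 2) h'
  have h₃ := congrArg (Polynomial.coeff · 3) h'
  simp [Polynomial.coeff_mul_X_pow', h.coeff_one_map] at h₂ h₃
  exact ⟨h₂, h₃⟩

theorem genInDegLE_one_regular_point (h : IsCuspidalCubic x y φ) :
    GenInDegLE (reesKer ![x - 1, y - 1]) 1 := by
  refine genInDegLE_one_of_locally_principal (i₀ := 1) (i₁ := 0) (e₀ := y - 1) (e₁ := y + 1)
    (c₀ := ![x - 1, y - 1]) (c₁ := ![y + 1, x ^ 2 + x + 1]) ?_ ?_ ?_ ?_ ?_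
  · intro j
    fin_cases j <;> simp [mul_comm]
  · intro j
    fin_cases j
    · simp
    · simp only [Fin.mk_one, Matrix.cons_val_one, Matrix.cons_val_zero, Matrix.cons_val_fin_one]
      linear_combination -h.rel
  · refine h.mem_nonZeroDivisors fun h0 => ?_
    have := congrArg (Polynomial.coeff · 3) h0
    simp [h.map_y, Polynomial.coeff_one] at this
  · refine h.mem_nonZeroDivisors fun h0 => ?_
    have := congrArg (Polynomial.coeff · 2) h0
    simp [h.map_x, Polynomial.coeff_one] at this
  · refine ⟨-algebraMap ℂ R (1 / 2), algebraMap ℂ R (1 / 2), ?_⟩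
    have : algebraMap ℂ R (1 / 2) * 2 = 1 := by
      rw [← map_ofNat (algebraMap ℂ R) 2, ← map_mul]
      norm_num
    linear_combination this

theorem not_genInDegLE_one_origin (h : IsCuspidalCubic x y φ) :
    ¬ GenInDegLE (reesKer ![x, y]) 1 := by
  intro hgen
  let ψ : MvPolynomial (Fin 2) R →+* MvPolynomial (Fin 2) ℂ :=
    MvPolynomial.map (Polynomial.constantCoeff.comp φ.toRingHom)
  have hle : reesKer ![x, y] ≤ RingHom.ker ψ := by
    refine (genInDegLE_iff_le.1 hgen).trans (Ideal.span_le.2 ?_)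
    rintro p ⟨hp, q, hq, hom⟩
    rw [mem_reesKer] at hp
    rw [SetLike.mem_coe, RingHom.mem_ker]
    interval_cases q
    · rw [← MvPolynomial.totalDegree_zero_iff_isHomogeneous,
        MvPolynomial.totalDegree_eq_zero_iff_eq_C] at hom
      rw [hom, MvPolynomial.aeval_C, Polynomial.algebraMap_eq, Polynomial.C_eq_zero] at hp
      rw [hom, hp, map_zero, map_zero]
    · obtain ⟨c, rfl⟩ := hom.exists_eq_sum_C_mul_X
      have hc := congrArg (Polynomial.coeff · 1) hp
      simp [Fin.sum_univ_two, Polynomial.algebraMap_eq] at hc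
      obtain ⟨h₀, h₁⟩ := h.coeff_zero_map_of_syzygy hc
      simp [ψ, Fin.sum_univ_two, h₀, h₁]
  have hmem : MvPolynomial.C x * MvPolynomial.X 0 ^ 2 - MvPolynomial.X 1 ^ 2 ∈
      reesKer ![x, y] := by
    have := congrArg Polynomial.C h.rel
    simp [mem_reesKer, Polynomial.algebraMap_eq] at this ⊢
    linear_combination Polynomial.X ^ 2 * this
  have := hle hmem
  simp [RingHom.mem_ker, ψ, h.map_x] at this

/-- Modulo the three standard equations, every element of `R[T, U]` has a normal form
`A(x, T) + B(x, T) U + c(x) y`. -/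
theorem exists_normal_form (h : IsCuspidalCubic x y φ) {J : Ideal (MvPolynomial (Fin 2) R)}
    (h₁ : MvPolynomial.C y * MvPolynomial.X 0 - MvPolynomial.C x * MvPolynomial.X 1 ∈ J)
    (h₂ : MvPolynomial.C (x ^ 2) * MvPolynomial.X 0 - MvPolynomial.C y * MvPolynomial.X 1 ∈ J)
    (h₃ : MvPolynomial.C x * MvPolynomial.X 0 ^ 2 - MvPolynomial.X 1 ^ 2 ∈ J)
    (p : MvPolynomial (Fin 2) R) :
    ∃ (A B : Polynomial (Polynomial ℂ)) (c : Polynomial ℂ),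
      p - (A.eval₂ (MvPolynomial.C.comp (Polynomial.aeval x).toRingHom) (MvPolynomial.X 0) +
        B.eval₂ (MvPolynomial.C.comp (Polynomial.aeval x).toRingHom) (MvPolynomial.X 0) *
          MvPolynomial.X 1 + MvPolynomial.C (Polynomial.aeval x c * y)) ∈ J := by
  induction p using MvPolynomial.induction_on with
  | C r =>
    obtain ⟨a, b, rfl⟩ := h.exists_repr r
    exact ⟨Polynomial.C a, 0, b, by simp⟩
  | add p q hp hq =>
    obtain ⟨A, B, c, hp⟩ := hp
    obtain ⟨A', B', c', hq⟩ := hq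
    refine ⟨A + A', B + B', c + c', ?_⟩
    convert J.add_mem hp hq using 1
    simp only [Polynomial.eval₂_add, map_add, add_mul]
    ring
  | mul_X p i hp =>
    obtain ⟨A, B, c, hp⟩ := hp
    fin_cases i
    · refine ⟨Polynomial.X * A, Polynomial.X * B + Polynomial.C (Polynomial.X * c), 0, ?_⟩
      convert J.add_mem (J.mul_mem_left (MvPolynomial.X 0) hp)
        (J.mul_mem_left (MvPolynomial.C (Polynomial.aeval x c)) h₁) using 1
      simp
      ring
    · refine ⟨Polynomial.C Polynomial.X * Polynomial.X ^ 2 * B +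
        Polynomial.C (Polynomial.X * Polynomial.X * c) * Polynomial.X, A, 0, ?_⟩
      convert J.sub_mem (J.sub_mem (J.mul_mem_left (MvPolynomial.X 1) hp)
        (J.mul_mem_left (MvPolynomial.C (Polynomial.aeval x c)) h₂))
        (J.mul_mem_left (B.eval₂ (MvPolynomial.C.comp (Polynomial.aeval x).toRingHom)
          (MvPolynomial.X 0)) h₃) using 1
      simp
      ring

theorem normal_form_eq_zero (h : IsCuspidalCubic x y φ) {A B : Polynomial (Polynomial ℂ)}
    {c : Polynomial ℂ}
    (hmem : A.eval₂ (MvPolynomial.C.comp (Polynomial.aeval x).toRingHom) (MvPolynomial.X 0) +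
        B.eval₂ (MvPolynomial.C.comp (Polynomial.aeval x).toRingHom) (MvPolynomial.X 0) *
          MvPolynomial.X 1 + MvPolynomial.C (Polynomial.aeval x c * y) ∈ reesKer ![x, y]) :
    A = 0 ∧ B = 0 ∧ c = 0 := by
  have key (D : Polynomial (Polynomial ℂ)) : MvPolynomial.aeval
      (fun i => Polynomial.C (![x, y] i) * Polynomial.X : Fin 2 → Polynomial R)
      (D.eval₂ (MvPolynomial.C.comp (Polynomial.aeval x).toRingHom) (MvPolynomial.X 0)) =
      (D.map (Polynomial.aeval x).toRingHom).comp (Polynomial.C x * Polynomial.X) := by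
    induction D using Polynomial.induction_on' with
    | add p q hp hq => simp only [Polynomial.eval₂_add, map_add, hp, hq, Polynomial.map_add,
        Polynomial.add_comp]
    | monomial n a => simp [Polynomial.eval₂_monomial, Polynomial.algebraMap_eq]
  rw [mem_reesKer, map_add, map_add, map_mul, key, key, MvPolynomial.aeval_X,
    MvPolynomial.aeval_C, Polynomial.algebraMap_eq] at hmem
  have h0 := congrArg (Polynomial.coeff · 0) hmem
  have hsucc (n : ℕ) := congrArg (Polynomial.coeff · (n + 1)) hmem
  simp only [Polynomial.coeff_add, ← mul_assoc, Polynomial.coeff_mul_X,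
    Polynomial.coeff_mul_X_zero, Polynomial.coeff_mul_C, Polynomial.comp_C_mul_X_coeff,
    Polynomial.coeff_map, Polynomial.coeff_C_zero, Polynomial.coeff_C_succ,
    Polynomial.coeff_zero, Matrix.cons_val_one, Matrix.cons_val_fin_one] at h0 hsucc
  have h0' := h.repr_eq_zero (a := A.coeff 0) (b := c) (by simpa using h0)
  have hsucc' (n : ℕ) := h.repr_eq_zero (a := A.coeff (n + 1) * Polynomial.X ^ (n + 1))
    (b := B.coeff n * Polynomial.X ^ n) (by simpa using hsucc n)
  refine ⟨?_, ?_, h0'.2⟩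
  · ext1 n
    cases n with
    | zero => exact h0'.1
    | succ n => simpa using (hsucc' n).1
  · ext1 n
    simpa using (hsucc' n).2

theorem genInDegLE_two_origin (h : IsCuspidalCubic x y φ) : GenInDegLE (reesKer ![x, y]) 2 := by
  rw [genInDegLE_iff_le]
  intro p hp
  set J := Ideal.span {p | p ∈ reesKer ![x, y] ∧ ∃ q ≤ 2, MvPolynomial.IsHomogeneous p q}
  have hJ : J ≤ reesKer ![x, y] := Ideal.span_le.2 fun _ hp => hp.1
  have h₁ : MvPolynomial.C y * MvPolynomial.X 0 - MvPolynomial.C x * MvPolynomial.X 1 ∈ J := by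
    refine Ideal.subset_span ⟨?_, 1, one_le_two, (MvPolynomial.isHomogeneous_C_mul_X _ _).sub
      (MvPolynomial.isHomogeneous_C_mul_X _ _)⟩
    simp [mem_reesKer, Polynomial.algebraMap_eq]
    ring
  have h₂ : MvPolynomial.C (x ^ 2) * MvPolynomial.X 0 -
      MvPolynomial.C y * MvPolynomial.X 1 ∈ J := by
    refine Ideal.subset_span ⟨?_, 1, one_le_two, (MvPolynomial.isHomogeneous_C_mul_X _ _).sub
      (MvPolynomial.isHomogeneous_C_mul_X _ _)⟩
    have := congrArg Polynomial.C h.rel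
    simp [mem_reesKer, Polynomial.algebraMap_eq] at this ⊢
    linear_combination Polynomial.X * this
  have h₃ : MvPolynomial.C x * MvPolynomial.X 0 ^ 2 - MvPolynomial.X 1 ^ 2 ∈ J := by
    refine Ideal.subset_span ⟨?_, 2, le_rfl, ?_⟩
    · have := congrArg Polynomial.C h.rel
      simp [mem_reesKer, Polynomial.algebraMap_eq] at this ⊢
      linear_combination Polynomial.X ^ 2 * this
    · refine MvPolynomial.IsHomogeneous.sub ?_ (MvPolynomial.isHomogeneous_X_pow _ _)
      exact MvPolynomial.isHomogeneous_C_mul_X_pow _ _ _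
  obtain ⟨A, B, c, hnf⟩ := h.exists_normal_form h₁ h₂ h₃ p
  obtain ⟨rfl, rfl, rfl⟩ := h.normal_form_eq_zero
    (by simpa only [sub_sub_cancel] using (reesKer ![x, y]).sub_mem hp (hJ hnf))
  simpa using hnf

theorem relType_regular_point (h : IsCuspidalCubic x y φ) : relType (Ideal.span {x - 1, y - 1}) = 1 := by
  rw [relType_eq_sInf_s3 ![x - 1, y - 1] (by simp [Set.pair_comm])]
  exact le_antisymm (Nat.sInf_le ⟨le_rfl, h.genInDegLE_one_regular_point⟩)
    (le_csInf ⟨1, le_rfl, h.genInDegLE_one_regular_point⟩ fun _ hN => hN.1)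

theorem relType_origin (h : IsCuspidalCubic x y φ) : relType (Ideal.span {x, y}) = 2 := by
  rw [relType_eq_sInf_s3 ![x, y] (by simp [Set.pair_comm])]
  refine le_antisymm (Nat.sInf_le ⟨one_le_two, h.genInDegLE_two_origin⟩)
    (le_csInf ⟨2, one_le_two, h.genInDegLE_two_origin⟩ fun N hN => ?_)
  by_contra! hlt
  obtain rfl : N = 1 := by have := hN.1; omega
  exact h.not_genInDegLE_one_origin hN.2

end IsCuspidalCubic

theorem exists_isCuspidalCubic_quotient :
    let J : Ideal (MvPolynomial (Fin 2) ℂ) :=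
      Ideal.span {(MvPolynomial.X 0 : MvPolynomial (Fin 2) ℂ) ^ 3 - MvPolynomial.X 1 ^ 2}
    ∃ φ : MvPolynomial (Fin 2) ℂ ⧸ J →ₐ[ℂ] Polynomial ℂ,
      IsCuspidalCubic (Ideal.Quotient.mk J (MvPolynomial.X 0)) (Ideal.Quotient.mk J (MvPolynomial.X 1))
        φ := by
  intro J
  let θ : MvPolynomial (Fin 2) ℂ →ₐ[ℂ] Polynomial ℂ :=
    MvPolynomial.aeval ![Polynomial.X ^ 2, Polynomial.X ^ 3]
  have hθ : ∀ p ∈ J, θ p = 0 := by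
    refine fun p hp => (Ideal.span_le (I := RingHom.ker θ)).2 ?_ hp
    rw [Set.singleton_subset_iff, SetLike.mem_coe, RingHom.mem_ker]
    simp [θ]
    ring
  have hrel : (Ideal.Quotient.mk J (MvPolynomial.X 0)) ^ 3 =
      (Ideal.Quotient.mk J (MvPolynomial.X 1)) ^ 2 := by
    rw [← map_pow, ← map_pow, Ideal.Quotient.eq]
    exact Ideal.subset_span rfl
  refine ⟨Ideal.Quotient.liftₐ J θ hθ, hrel, ?_, ?_, fun r => ?_⟩
  · exact (Ideal.Quotient.lift_mk J θ.toRingHom hθ).trans (by simp [θ])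
  · exact (Ideal.Quotient.lift_mk J θ.toRingHom hθ).trans (by simp [θ])
  · obtain ⟨p, rfl⟩ := Ideal.Quotient.mk_surjective r
    induction p using MvPolynomial.induction_on with
    | C z => exact ⟨Polynomial.C z, 0, by simp; rfl⟩
    | add p q hp hq =>
      obtain ⟨a, b, hp⟩ := hp
      obtain ⟨a', b', hq⟩ := hq
      refine ⟨a + a', b + b', ?_⟩
      rw [map_add, hp, hq, map_add, map_add]
      ring
    | mul_X p i hp =>
      obtain ⟨a, b, hp⟩ := hp
      fin_cases i
      · refine ⟨Polynomial.X * a, Polynomial.X * b, ?_⟩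
        simp only [map_mul, hp, Polynomial.aeval_X, Fin.zero_eta]
        ring
      · refine ⟨Polynomial.X ^ 3 * b, a, ?_⟩
        simp only [map_mul, map_pow, hp, Polynomial.aeval_X, Fin.mk_one, hrel]
        ring

end Cusp

/-- In the coordinate ring `R = ℂ[x,y]/(x³ - y²)` of Neile's semicubical parabola, the maximal
ideal `𝔪 = (x̄-1, ȳ-1)` at the regular point `(1,1)` has relation type `1`, whereas the maximal
ideal `𝔫 = (x̄, ȳ)` at the origin has relation type `2`. -/
theorem relType_neile_parabola :
    let R := MvPolynomial (Fin 2) ℂ ⧸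
      Ideal.span {(X 0 : MvPolynomial (Fin 2) ℂ) ^ 3 - X 1 ^ 2}
    let π : MvPolynomial (Fin 2) ℂ →+* R :=
      Ideal.Quotient.mk (Ideal.span {(X 0 : MvPolynomial (Fin 2) ℂ) ^ 3 - X 1 ^ 2})
    let 𝔪 : Ideal R := Ideal.span {π (X 0) - 1, π (X 1) - 1}
    let 𝔫 : Ideal R := Ideal.span {π (X 0), π (X 1)}
    relType 𝔪 = 1 ∧ relType 𝔫 = 2 := by
  intro R π 𝔪 𝔫
  obtain ⟨φ, h⟩ := exists_isCuspidalCubic_quotient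
  exact ⟨h.relType_regular_point, h.relType_origin⟩
end
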